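/- arXiv:2406.12261 — 7 statements merged into one kernel-verified Lean document; each statement's English description precedes it below -/
import Mathlib

section
/- Let ρ_M and ρ_N be coactions on M and N, let X ⊆ A be a subspace, and let f : M → N be a k-linear map with ρ_N ∘ f = (f ⊗ id_A) ∘ ρ_M. If M is an X-comodule, then the range of f is contained in N_X, the supremum of all X-subcomodules of N. (This is the key step in Theorem 2.4(3) of the paper: the functor (-)_X is right adjoint to the inclusion of X-comodules.) -/
open TensorProduct

/-- The image in `M ⊗[k] A` of `N ⊗[k] X` under the tensor product of the inclusion maps. -/
noncomputable def tmulSub {k M A : Type*} [Field k] [AddCommGroup M] [Module k M]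
    [AddCommGroup A] [Module k A] (N : Submodule k M) (X : Submodule k A) :
    Submodule k (M ⊗[k] A) :=
  LinearMap.range (TensorProduct.map N.subtype X.subtype)

/-- `M_X`: the supremum of all `X`-subcomodules of `M`. -/
noncomputable def subMX {k M A : Type*} [Field k] [AddCommGroup M] [Module k M]
    [AddCommGroup A] [Module k A] (ρ : M →ₗ[k] M ⊗[k] A) (X : Submodule k A) :
    Submodule k M :=
  sSup {N : Submodule k M | ∀ n ∈ N, ρ n ∈ tmulSub N X}

/-- Key step in Theorem 2.4(3): if `f : M → N` is a map of comodules and `M` is an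
`X`-comodule, then the range of `f` is contained in `N_X`. -/
theorem stmt_4 {k M N A : Type*} [Field k] [AddCommGroup M] [Module k M]
    [AddCommGroup N] [Module k N] [AddCommGroup A] [Module k A]
    (ρM : M →ₗ[k] M ⊗[k] A) (ρN : N →ₗ[k] N ⊗[k] A) (X : Submodule k A)
    (f : M →ₗ[k] N)
    (hcomm : ρN ∘ₗ f = (LinearMap.rTensor A f) ∘ₗ ρM)
    (hM : ∀ m : M, ρM m ∈ tmulSub (⊤ : Submodule k M) X) :
    LinearMap.range f ≤ subMX ρN X := by
  apply le_sSup
  rintro _ ⟨m, rfl⟩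
  have h : ρN (f m) = LinearMap.rTensor A f (ρM m) := LinearMap.congr_fun hcomm m
  rw [h]
  obtain ⟨t, ht⟩ := hM m
  rw [← ht]
  clear ht h
  induction t using TensorProduct.induction_on with
  | zero => simp only [map_zero]; exact Submodule.zero_mem _
  | tmul a x =>
    exact ⟨(⟨f a, a, rfl⟩ : LinearMap.range f) ⊗ₜ[k] x, by simp⟩
  | add a b ha hb =>
    rw [map_add, map_add]
    exact Submodule.add_mem _ ha hb
end

section
/- Let A be a coalgebra over k, let ρ be a comodule structure on M, and let (X_i)_{i ∈ ℕ} be an ascending sequence of subspaces of A (X_i ⊆ X_{i+1} for all i) whose union is all of A. Then the ascending sequence of subspaces M_{X_i} exhausts M: ⨆_i M_{X_i} = M, i.e. every element of M lies in M_{X_i} for some i. (Proposition 2.7 of the paper.) -/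
open TensorProduct

theorem tmul_mem_tmulSub {k M A : Type*} [Field k] [AddCommGroup M] [Module k M]
    [AddCommGroup A] [Module k A] {N : Submodule k M} {X : Submodule k A} {n : M} {a : A}
    (hn : n ∈ N) (ha : a ∈ X) : n ⊗ₜ[k] a ∈ tmulSub N X :=
  ⟨(⟨n, hn⟩ : N) ⊗ₜ[k] (⟨a, ha⟩ : X), by simp⟩

theorem tmulSub_le {k M A : Type*} [Field k] [AddCommGroup M] [Module k M]
    [AddCommGroup A] [Module k A] {N : Submodule k M} {X : Submodule k A}
    {P : Submodule k (M ⊗[k] A)} (h : ∀ n ∈ N, ∀ a ∈ X, n ⊗ₜ[k] a ∈ P) :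
    tmulSub N X ≤ P := by
  rintro _ ⟨z, rfl⟩
  induction z using TensorProduct.induction_on with
  | zero => simp
  | tmul x y => simpa using h x x.2 y y.2
  | add x y hx hy => rw [map_add]; exact P.add_mem hx hy

theorem tmulSub_mono {k M A : Type*} [Field k] [AddCommGroup M] [Module k M]
    [AddCommGroup A] [Module k A] {N : Submodule k M} {X Y : Submodule k A} (h : X ≤ Y) :
    tmulSub N X ≤ tmulSub N Y :=
  tmulSub_le fun _ hn _ ha => tmul_mem_tmulSub hn (h ha)

theorem exists_fg_sub {k M A : Type*} [Field k] [AddCommGroup M] [Module k M]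
    [AddCommGroup A] [Module k A] [Coalgebra k A]
    (ρ : M →ₗ[k] M ⊗[k] A)
    (hcoassoc : (TensorProduct.assoc k M A A).toLinearMap ∘ₗ (LinearMap.rTensor A ρ) ∘ₗ ρ =
      (LinearMap.lTensor M (Coalgebra.comul (R := k) (A := A))) ∘ₗ ρ)
    (hcounit : (TensorProduct.rid k M).toLinearMap ∘ₗ
      (LinearMap.lTensor M (Coalgebra.counit (R := k) (A := A))) ∘ₗ ρ = LinearMap.id)
    (m : M) : ∃ S : Finset M, m ∈ Submodule.span k (S : Set M) ∧
      ∀ n ∈ S, ρ n ∈ tmulSub (Submodule.span k (S : Set M)) ⊤ := by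
  classical
  let b := Module.Free.chooseBasis k A
  let c := TensorProduct.equivFinsuppOfBasisRight (M := M) b (ρ m)
  let S : Finset M := c.support.image c
  have hc : ρ m = c.sum fun i x => x ⊗ₜ[k] b i := by
    rw [← TensorProduct.equivFinsuppOfBasisRight_symm_apply, LinearEquiv.symm_apply_apply]
  have hρm : ρ m ∈ tmulSub (Submodule.span k (S : Set M)) ⊤ := by
    rw [hc]
    refine Submodule.sum_mem _ fun i hi => tmul_mem_tmulSub (Submodule.subset_span ?_) trivial
    exact Finset.mem_coe.2 (Finset.mem_image_of_mem _ hi)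
  refine ⟨S, ?_, ?_⟩
  · have h1 : tmulSub (Submodule.span k (S : Set M)) ⊤ ≤
        (Submodule.span k (S : Set M)).comap ((TensorProduct.rid k M).toLinearMap ∘ₗ
      (LinearMap.lTensor M (Coalgebra.counit (R := k) (A := A)))) := by
      refine tmulSub_le fun n hn a _ => ?_
      simpa using Submodule.smul_mem _ _ hn
    have h2 := h1 hρm
    have h3 := LinearMap.congr_fun hcounit m
    simp only [LinearMap.comp_apply, LinearMap.id_apply] at h3
    simpa only [Submodule.mem_comap, LinearMap.comp_apply, h3] using h2
  · intro n hn
    obtain ⟨i, -, rfl⟩ := Finset.mem_image.1 hn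
    have hci : c i = TensorProduct.rid k M (LinearMap.lTensor M (b.coord i) (ρ m)) := by
      simp only [c]
      generalize ρ m = z
      induction z using TensorProduct.induction_on with
      | zero => simp
      | tmul x y => simp
      | add x y hx hy => simp [hx, hy]
    let g : A →ₗ[k] A := (TensorProduct.rid k A).toLinearMap ∘ₗ
      (LinearMap.lTensor A (b.coord i)) ∘ₗ Coalgebra.comul (R := k) (A := A)
    have e1 : ∀ z : M ⊗[k] A, ρ (TensorProduct.rid k M (LinearMap.lTensor M (b.coord i) z)) =
        LinearMap.lTensor M ((TensorProduct.rid k A).toLinearMap ∘ₗ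
          (LinearMap.lTensor A (b.coord i)))
          (TensorProduct.assoc k M A A (LinearMap.rTensor A ρ z)) := by
      intro z
      induction z using TensorProduct.induction_on with
      | zero => simp
      | tmul x y =>
        simp only [LinearMap.lTensor_tmul, TensorProduct.rid_tmul, map_smul,
          LinearMap.rTensor_tmul]
        generalize ρ x = w
        induction w using TensorProduct.induction_on with
        | zero => simp
        | tmul u v => simp
        | add u v hu hv => simp only [smul_add, hu, hv, TensorProduct.add_tmul, map_add]
      | add x y hx hy => simp only [map_add, hx, hy]
    have e2 : ρ (c i) = LinearMap.lTensor M g (ρ m) := by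
      rw [hci, e1]
      have h3 := LinearMap.congr_fun hcoassoc m
      simp only [LinearMap.comp_apply, LinearEquiv.coe_coe] at h3
      rw [h3, ← LinearMap.comp_apply, ← LinearMap.lTensor_comp]
      rfl
    rw [e2]
    have h1 : tmulSub (Submodule.span k (S : Set M)) ⊤ ≤
        (tmulSub (Submodule.span k (S : Set M)) ⊤).comap (LinearMap.lTensor M g) := by
      refine tmulSub_le fun n hn a _ => ?_
      exact tmul_mem_tmulSub hn (Submodule.mem_top (x := g a))
    exact h1 hρm

/-- Proposition 2.7: for a comodule `M` over a coalgebra `A` and an ascending sequence of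
subspaces `X i` of `A` whose union is all of `A`, the subspaces `M_{X i}` exhaust `M`. -/
theorem stmt_5 {k M A : Type*} [Field k] [AddCommGroup M] [Module k M]
    [AddCommGroup A] [Module k A] [Coalgebra k A]
    (ρ : M →ₗ[k] M ⊗[k] A)
    (hcoassoc : (TensorProduct.assoc k M A A).toLinearMap ∘ₗ (LinearMap.rTensor A ρ) ∘ₗ ρ =
      (LinearMap.lTensor M (Coalgebra.comul (R := k) (A := A))) ∘ₗ ρ)
    (hcounit : (TensorProduct.rid k M).toLinearMap ∘ₗ
      (LinearMap.lTensor M (Coalgebra.counit (R := k) (A := A))) ∘ₗ ρ = LinearMap.id)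
    (X : ℕ → Submodule k A)
    (hasc : ∀ i, X i ≤ X (i + 1))
    (hconv : (⨆ i, X i) = (⊤ : Submodule k A)) :
    (∀ m : M, ∃ i, m ∈ subMX ρ (X i)) ∧ (⨆ i, subMX ρ (X i)) = (⊤ : Submodule k M) := by
  have hmono : Monotone X := monotone_nat_of_le_succ hasc
  have key : ∀ m : M, ∃ i, m ∈ subMX ρ (X i) := by
    intro m
    obtain ⟨S, hm, hS⟩ := exists_fg_sub ρ hcoassoc hcounit m
    have hdir : Directed (· ≤ ·) fun i => tmulSub (Submodule.span k (S : Set M)) (X i) :=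
      Monotone.directed_le fun i j h => tmulSub_mono (hmono h)
    have h1 : tmulSub (Submodule.span k (S : Set M)) ⊤ ≤
        ⨆ i, tmulSub (Submodule.span k (S : Set M)) (X i) := by
      refine tmulSub_le fun n hn a _ => ?_
      have ha : a ∈ ⨆ i, X i := hconv ▸ trivial
      obtain ⟨i, hi⟩ := (Submodule.mem_iSup_of_directed _ hmono.directed_le).1 ha
      exact Submodule.mem_iSup_of_mem i (tmul_mem_tmulSub hn hi)
    have h2 : ∀ n : M, ∃ i, n ∈ S → ρ n ∈ tmulSub (Submodule.span k (S : Set M)) (X i) := by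
      intro n
      by_cases hn : n ∈ S
      · obtain ⟨i, hi⟩ := (Submodule.mem_iSup_of_directed _ hdir).1 (h1 (hS n hn))
        exact ⟨i, fun _ => hi⟩
      · exact ⟨0, fun h => absurd h hn⟩
    choose f hf using h2
    refine ⟨S.sup f, ?_⟩
    have h3 : Submodule.span k (S : Set M) ≤
        (tmulSub (Submodule.span k (S : Set M)) (X (S.sup f))).comap ρ := by
      refine Submodule.span_le.2 fun n hn => ?_
      exact tmulSub_mono (hmono (Finset.le_sup (f := f) hn)) (hf n hn)
    have h4 : Submodule.span k (S : Set M) ≤ subMX ρ (X (S.sup f)) := by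
      unfold subMX
      apply le_sSup
      intro n hn
      exact h3 hn
    exact h4 hm
  refine ⟨key, eq_top_iff.2 fun m _ => ?_⟩
  obtain ⟨i, hi⟩ := key m
  exact Submodule.mem_iSup_of_mem i hi
end

section
/- For all d, e ∈ ℕ, if u ∈ O(GL_N)_{≤d} and v ∈ O(GL_N)_{≤e} then the product u·v lies in O(GL_N)_{≤d+e}; that is, multiplication in L restricts to O(GL_N)_{≤d} ⊗ O(GL_N)_{≤e} → O(GL_N)_{≤d+e}. (Proposition 3.5(4) of the paper.) -/
open MvPolynomial

/-- The determinant of the generic `N × N` matrix: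
`det = ∑ σ, sign σ • ∏ i, X (i, σ i)` in `P = MvPolynomial (Fin N × Fin N) k`. -/
noncomputable def genericDet (N : ℕ) (k : Type*) [Field k] :
    MvPolynomial (Fin N × Fin N) k :=
  ∑ σ : Equiv.Perm (Fin N),
    (Equiv.Perm.sign σ : ℤ) • ∏ i : Fin N, MvPolynomial.X (i, σ i)

/-- `O(GL_N)`: the localization of `P = MvPolynomial (Fin N × Fin N) k` away from the
generic determinant. -/
abbrev GLCoord (N : ℕ) (k : Type*) [Field k] :=
  Localization.Away (genericDet N k)

/-- `O(GL_N)_{≤ d}`: the `k`-span of the elements `ι g · ((ι det)⁻¹)^i` with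
`totalDegree g + i·N ≤ d`, where `ι` is the localization map and `(ι det)⁻¹` is the
inverse of the determinant in the localization. -/
noncomputable def glFilt (N : ℕ) (k : Type*) [Field k] (d : ℕ) :
    Submodule k (GLCoord N k) :=
  Submodule.span k
    {y : GLCoord N k | ∃ (i : ℕ) (g : MvPolynomial (Fin N × Fin N) k),
      g.totalDegree + i * N ≤ d ∧
      y = algebraMap (MvPolynomial (Fin N × Fin N) k) (GLCoord N k) g *
        (Localization.Away.invSelf (genericDet N k)) ^ i}

/-- Proposition 3.5(4): multiplication in `O(GL_N)` restricts to
`O(GL_N)_{≤ d} ⊗ O(GL_N)_{≤ e} → O(GL_N)_{≤ d+e}`. -/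
theorem stmt_12 {k : Type*} [Field k] (N : ℕ) (hN : 1 ≤ N) (d e : ℕ)
    (u v : GLCoord N k) (hu : u ∈ glFilt N k d) (hv : v ∈ glFilt N k e) :
    u * v ∈ glFilt N k (d + e) := by
  have h := Submodule.mul_mem_mul hu hv
  unfold glFilt at h
  rw [Submodule.span_mul_span] at h
  unfold glFilt
  refine Submodule.span_mono ?_ h
  rintro _ ⟨_, ⟨i, f, hf, rfl⟩, _, ⟨j, g, hg, rfl⟩, rfl⟩
  refine ⟨i + j, f * g, ?_, ?_⟩
  · have := MvPolynomial.totalDegree_mul f g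
    rw [add_mul]
    omega
  · simp only [map_mul, pow_add]
    ring
end

section
/- For every d ∈ ℕ, the subspace O(GL_N)_{≤d} ⊆ L is finite-dimensional over k, and its dimension satisfies the bounds choose(d + N², N²) ≤ dim_k O(GL_N)_{≤d} ≤ Σ_{i=0}^{⌊d/N⌋} choose(d − i·N + N², N²). (Display (3.10) in the proof of Proposition 3.5(3) of the paper.) -/
open MvPolynomial

theorem aux_finrank_restrict (σ k : Type*) [Fintype σ] [Field k] (m : ℕ) :
    Module.finrank k (restrictTotalDegree σ k m) =
      Nat.choose (m + Fintype.card σ) (Fintype.card σ) := by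
  classical
  have hb := Module.finrank_eq_nat_card_basis
    (basisRestrictSupport k { n : σ →₀ ℕ | (n.sum fun _ e => e) ≤ m })
  have hs : { n : σ →₀ ℕ | (n.sum fun _ e => e) ≤ m } =
      (((Finset.range (m + 1)).biUnion
        fun j => (Finset.univ : Finset σ).finsuppAntidiag j : Finset (σ →₀ ℕ)) :
          Set (σ →₀ ℕ)) := by
    ext f
    simp [Finsupp.sum_fintype, Nat.lt_succ_iff]
  rw [hs] at hb
  unfold restrictTotalDegree
  rw [hs, hb, ← Nat.sum_range_multichoose]
  simp only [SetLike.coe_sort_coe, Nat.card_eq_fintype_card, Fintype.card_coe]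
  rw [Finset.card_biUnion]
  · simp [Finset.card_finsuppAntidiag_nat_eq_multichoose]
  · intro a _ b _ hab
    rw [Function.onFun, Finset.disjoint_left]
    intro f hf hg
    simp only [Finset.mem_finsuppAntidiag] at hf hg
    exact hab (hf.1.symm.trans hg.1)

theorem aux_finrank_sum {k V ι : Type*} [Field k] [AddCommGroup V] [Module k V]
    (W : ι → Submodule k V) [∀ i, FiniteDimensional k (W i)] (s : Finset ι) :
    FiniteDimensional k (s.sup W : Submodule k V) ∧
    Module.finrank k (s.sup W : Submodule k V) ≤ ∑ i ∈ s, Module.finrank k (W i) := by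
  classical
  induction s using Finset.induction_on with
  | empty => rw [Finset.sup_empty]; exact ⟨inferInstance, by simp⟩
  | insert a s ha ih =>
    obtain ⟨h1, h2⟩ := ih
    rw [Finset.sup_insert, Finset.sum_insert ha]
    refine ⟨inferInstance, ?_⟩
    exact (Submodule.finrank_add_le_finrank_add_finrank _ _).trans (by omega)

theorem aux_det_ne_zero (N : ℕ) (k : Type*) [Field k] : genericDet N k ≠ 0 := by
  have h := Matrix.det_mvPolynomialX_ne_zero (Fin N) k
  rw [← Matrix.det_transpose, Matrix.det_apply] at h
  simpa [genericDet, Units.smul_def] using h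

/-- The map `g ↦ ι g * det⁻ⁱ`. -/
noncomputable def auxMap (N : ℕ) (k : Type*) [Field k] (i : ℕ) :
    MvPolynomial (Fin N × Fin N) k →ₗ[k] GLCoord N k :=
  LinearMap.mulRight k ((Localization.Away.invSelf (genericDet N k)) ^ i) ∘ₗ
    (IsScalarTower.toAlgHom k (MvPolynomial (Fin N × Fin N) k) (GLCoord N k)).toLinearMap

theorem auxMap_apply (N : ℕ) (k : Type*) [Field k] (i : ℕ)
    (g : MvPolynomial (Fin N × Fin N) k) : auxMap N k i g =
    algebraMap (MvPolynomial (Fin N × Fin N) k) (GLCoord N k) g *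
        (Localization.Away.invSelf (genericDet N k)) ^ i := rfl

/-- Display (3.10) in the proof of Proposition 3.5(3): `O(GL_N)_{≤ d}` is finite
dimensional over `k`, with
`choose (d + N²) N² ≤ dim O(GL_N)_{≤ d} ≤ ∑_{i=0}^{⌊d/N⌋} choose (d - i·N + N²) N²`. -/
theorem stmt_13 {k : Type*} [Field k] (N : ℕ) (hN : 1 ≤ N) (d : ℕ) :
    FiniteDimensional k (glFilt N k d) ∧
    Nat.choose (d + N ^ 2) (N ^ 2) ≤ Module.finrank k (glFilt N k d) ∧
    Module.finrank k (glFilt N k d) ≤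
      ∑ i ∈ Finset.range (d / N + 1), Nat.choose (d - i * N + N ^ 2) (N ^ 2) := by
  have hc : Fintype.card (Fin N × Fin N) = N ^ 2 := by simp [sq]
  let W : ℕ → Submodule k (GLCoord N k) := fun i =>
    (restrictTotalDegree (Fin N × Fin N) k (d - i * N)).map (auxMap N k i)
  have hfr : ∀ m, Module.finrank k (restrictTotalDegree (Fin N × Fin N) k m) =
      Nat.choose (m + N ^ 2) (N ^ 2) := fun m => by rw [aux_finrank_restrict, hc]
  have hWf : ∀ i, FiniteDimensional k (W i) := fun i => inferInstance
  obtain ⟨hS, hle⟩ := aux_finrank_sum W (Finset.range (d / N + 1))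
  have hsub : glFilt N k d ≤ (Finset.range (d / N + 1)).sup W := by
    refine Submodule.span_le.2 ?_
    rintro y ⟨i, g, hd, rfl⟩
    have hi : i ∈ Finset.range (d / N + 1) := by
      rw [Finset.mem_range, Nat.lt_succ_iff, Nat.le_div_iff_mul_le hN]
      omega
    refine Finset.le_sup (f := W) hi ?_
    refine ⟨g, ?_, auxMap_apply N k i g⟩
    exact (mem_restrictTotalDegree _ _ _).2 (by omega)
  have hfin : FiniteDimensional k (glFilt N k d) := Submodule.finiteDimensional_of_le hsub
  refine ⟨hfin, ?_, ?_⟩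
  · have hinj : Function.Injective (auxMap N k 0) := by
      have := IsLocalization.injective (GLCoord N k) (M := Submonoid.powers (genericDet N k))
        (powers_le_nonZeroDivisors_of_noZeroDivisors (aux_det_ne_zero N k))
      intro a b hab
      rw [auxMap_apply, auxMap_apply, pow_zero, mul_one, mul_one] at hab
      exact this hab
    have h0 : (restrictTotalDegree (Fin N × Fin N) k d).map (auxMap N k 0) ≤ glFilt N k d := by
      rintro _ ⟨g, hg, rfl⟩
      refine Submodule.subset_span ⟨0, g, ?_, auxMap_apply N k 0 g⟩
      have := (mem_restrictTotalDegree _ _ _).1 hg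
      omega
    have h1 := Submodule.finrank_mono h0
    rw [← (Submodule.equivMapOfInjective _ hinj _).finrank_eq, hfr] at h1
    exact h1
  · refine (Submodule.finrank_mono hsub).trans (hle.trans (Finset.sum_le_sum fun i _ => ?_))
    rw [← hfr]
    exact Submodule.finrank_map_le _ _
end

section
/- Let d, e ∈ ℕ and let f, g ∈ L with f ≠ 0. If f ∈ O(GL_N)_{≤e} and f·g ∈ O(GL_N)_{≤d}, then g ∈ O(GL_N)_{≤d+e}. (The claim proved after Proposition 5.2 of the paper via unique factorization in O(M_{N,N}); it underlies the inclusion (M ⊗ N)_{≤d} ⊆ M ⊗ N_{≤d+e} for GL_N.) -/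
open MvPolynomial

section
variable {σ k : Type*} [Field k]

lemma hc_mul (F G : MvPolynomial σ k) (n : ℕ) :
    homogeneousComponent n (F * G) =
      ∑ p ∈ Finset.range (F.totalDegree + 1) ×ˢ Finset.range (G.totalDegree + 1),
        if p.1 + p.2 = n then homogeneousComponent p.1 F * homogeneousComponent p.2 G else 0 := by
  conv_lhs => rw [← sum_homogeneousComponent F, ← sum_homogeneousComponent G,
    Finset.sum_mul_sum, ← Finset.sum_product', map_sum]
  refine Finset.sum_congr rfl fun p _ => ?_
  rw [homogeneousComponent_of_mem (n := p.1 + p.2)]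
  · simp [eq_comm]
  · exact (homogeneousComponent_isHomogeneous _ _).mul (homogeneousComponent_isHomogeneous _ _)

def QQ (N : ℕ) (D : MvPolynomial σ k) (a e : ℕ) (F : MvPolynomial σ k) : Prop :=
  F.totalDegree ≤ e + a * N ∧
    ∀ j r, 2 * N * r + e < j + a * N + 2 * N → D ^ r ∣ homogeneousComponent j F

lemma exists_hc_ne {F : MvPolynomial σ k} (hF : F ≠ 0) : ∃ j, homogeneousComponent j F ≠ 0 := by
  by_contra! h
  apply hF
  rw [← sum_homogeneousComponent F]
  simp [h]

lemma exists_top (N : ℕ) (D : MvPolynomial σ k) {F : MvPolynomial σ k} (hF : F ≠ 0) :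
    ∃ j, homogeneousComponent j F ≠ 0 ∧ ∀ i, homogeneousComponent i F ≠ 0 →
      ((i : ℤ) + 2 * N * multiplicity D (homogeneousComponent j F) <
        j + 2 * N * multiplicity D (homogeneousComponent i F) ∨
      ((i : ℤ) + 2 * N * multiplicity D (homogeneousComponent j F) =
        j + 2 * N * multiplicity D (homogeneousComponent i F) ∧ i ≤ j)) := by
  classical
  obtain ⟨j0, hj0⟩ := exists_hc_ne hF
  have hle : ∀ i, homogeneousComponent i F ≠ 0 → i < F.totalDegree + 1 := by
    intro i hi
    by_contra h
    exact hi (homogeneousComponent_eq_zero _ _ (by omega))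
  obtain ⟨j, hj, hmax⟩ := Finset.exists_max_image
    ((Finset.range (F.totalDegree + 1)).filter fun i => homogeneousComponent i F ≠ 0)
    (fun i => toLex (((i : ℤ) - 2 * N * multiplicity D (homogeneousComponent i F)), i))
    ⟨j0, by simp [hj0]; have := hle _ hj0; omega⟩
  simp only [Finset.mem_filter, Finset.mem_range] at hj hmax
  refine ⟨j, hj.2, fun i hi => ?_⟩
  have := hmax i ⟨hle i hi, hi⟩
  rw [Prod.Lex.toLex_le_toLex] at this
  rcases this with h | ⟨h, h'⟩
  · left; simp only at h; linarith
  · right; simp only at h h'; exact ⟨by linarith, h'⟩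

lemma deg_ge {N : ℕ} {D : MvPolynomial σ k} (hD0 : D ≠ 0)
    (hh : D.IsHomogeneous N) {r j : ℕ} {F : MvPolynomial σ k} (hF : F.IsHomogeneous j)
    (hF0 : F ≠ 0) (h : D ^ r ∣ F) : r * N ≤ j := by
  obtain ⟨H, rfl⟩ := h
  have hH : H ≠ 0 := right_ne_zero_of_mul hF0
  have h1 := hF.totalDegree hF0
  rw [totalDegree_mul_of_isDomain (pow_ne_zero _ hD0) hH,
    (hh.pow r).totalDegree (pow_ne_zero _ hD0)] at h1
  nlinarith

lemma core {N : ℕ} {D : MvPolynomial σ k} (hN : 1 ≤ N) (hp : Prime D) (hh : D.IsHomogeneous N)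
    {a c d e : ℕ} {F G : MvPolynomial σ k} (hF0 : F ≠ 0) (hF : QQ N D a e F)
    (hFG : QQ N D (a + c) d (F * G)) : QQ N D c (d + e) G := by
  classical
  by_cases hG0 : G = 0
  · subst hG0; exact ⟨by simp, by simp⟩
  have fin : ∀ {H : MvPolynomial σ k}, H ≠ 0 → FiniteMultiplicity D H := fun h =>
    FiniteMultiplicity.of_prime_left hp h
  obtain ⟨j, hj0, hj⟩ := exists_top N D hF0
  obtain ⟨l, hl0, hl⟩ := exists_top N D hG0
  have hjdeg : j ≤ F.totalDegree := by
    by_contra h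
    exact hj0 (homogeneousComponent_eq_zero _ _ (by omega))
  set v := multiplicity D (homogeneousComponent j F) with hv
  set w := multiplicity D (homogeneousComponent l G) with hw
  have hvj : v * N ≤ j := deg_ge hp.ne_zero hh (homogeneousComponent_isHomogeneous _ _) hj0
    (pow_multiplicity_dvd _ _)
  have hF1 := hF.1
  have hFG1 := hFG.1
  have hFj : j + a * N ≤ e + 2 * N * v := by
    by_contra h
    have := hF.2 j (v + 1) (by rw [mul_add]; omega)
    have := (fin hj0).le_multiplicity_of_pow_dvd this
    omega
  have hnd : ¬ D ^ (v + w + 1) ∣ homogeneousComponent (j + l) (F * G) := by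
    intro hdvd
    have hne := mul_ne_zero hj0 hl0
    have hlast : ¬ D ^ (v + w + 1) ∣ homogeneousComponent j F * homogeneousComponent l G := by
      intro h
      have := (fin hne).le_multiplicity_of_pow_dvd h
      rw [multiplicity_mul hp (fin hne)] at this
      omega
    apply hlast
    have hldeg : l ≤ G.totalDegree := by
      by_contra h
      exact hl0 (homogeneousComponent_eq_zero _ _ (by omega))
    rw [hc_mul, ← Finset.add_sum_erase _ _ (a := (j, l)) (by simp; omega)] at hdvd
    simp only [if_true] at hdvd
    refine (dvd_add_left ?_).1 hdvd
    refine Finset.dvd_sum ?_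
    rintro ⟨i, m⟩ him
    simp only [Finset.mem_erase, ne_eq, Prod.mk.injEq] at him
    split_ifs with hs
    · by_cases hi0 : homogeneousComponent i F = 0
      · simp [hi0]
      by_cases hm0 : homogeneousComponent m G = 0
      · simp [hm0]
      refine pow_dvd_of_le_emultiplicity ?_ |>.trans dvd_rfl
      rw [(fin (mul_ne_zero hi0 hm0)).emultiplicity_eq_multiplicity,
        multiplicity_mul hp (fin (mul_ne_zero hi0 hm0))]
      have h1 := hj i hi0
      have h2 := hl m hm0
      have him' := him.1
      simp only at hs
      set v' := multiplicity D (homogeneousComponent i F)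
      set w' := multiplicity D (homogeneousComponent m G)
      norm_cast
      by_contra hlt
      have hlt : v' + w' ≤ v + w := by omega
      have hmul : 2 * (N : ℤ) * v' + 2 * N * w' ≤ 2 * N * v + 2 * N * w := by
        have : (2 * (N : ℤ)) * (v' + w') ≤ 2 * N * (v + w) := 
            mul_le_mul_of_nonneg_left (by exact_mod_cast hlt) (by positivity)
        linarith
      have hs' : (i : ℤ) + m = j + l := by exact_mod_cast hs
      rcases h1 with h1 | ⟨h1, h1'⟩ <;> rcases h2 with h2 | ⟨h2, h2'⟩
      · linarith
      · linarith
      · linarith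
      · omega
    · simp
  have key : j + l + (a + c) * N ≤ d + 2 * N * (v + w) := by
    by_contra h
    exact hnd (hFG.2 (j + l) (v + w + 1) (by rw [mul_add _ _ 1]; omega))
  refine ⟨?_, ?_⟩
  · rw [totalDegree_mul_of_isDomain hF0 hG0] at hFG1
    nlinarith
  · intro m r hr
    by_cases hm0 : homogeneousComponent m G = 0
    · simp [hm0]
    refine pow_dvd_of_le_emultiplicity ?_
    rw [(fin hm0).emultiplicity_eq_multiplicity]
    norm_cast
    have h2 := hl m hm0
    set w' := multiplicity D (homogeneousComponent m G)
    have h2' : m + 2 * N * w ≤ l + 2 * N * w' := by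
      zify; rcases h2 with h | h <;> linarith
    by_contra hlt
    have : 2 * N * (w' + 1) ≤ 2 * N * r := by gcongr; omega
    nlinarith
end

lemma genericDet_eq (N : ℕ) (k : Type*) [Field k] :
    genericDet N k = (Matrix.mvPolynomialX (Fin N) (Fin N) k).det := by
  rw [← Matrix.det_transpose, Matrix.det_apply]
  simp [genericDet, Matrix.mvPolynomialX, Units.smul_def]

lemma genericDet_hom (N : ℕ) (k : Type*) [Field k] :
    (genericDet N k).IsHomogeneous N := by
  rw [genericDet_eq]
  rw [Matrix.det_apply']
  refine IsHomogeneous.sum _ _ _ fun s _ => ?_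
  rw [← map_intCast (C : k →+* MvPolynomial (Fin N × Fin N) k)]
  refine IsHomogeneous.C_mul ?_ _
  have := IsHomogeneous.prod Finset.univ
    (fun i => Matrix.mvPolynomialX (Fin N) (Fin N) k (s i) i) (fun _ => 1)
    (fun i _ => by simpa using isHomogeneous_X k _)
  simpa using this

lemma prime_rename_of_inj {σ τ k : Type*} [Field k] {φ : σ → τ} (hφ : Function.Injective φ)
    {p : MvPolynomial σ k} (hp : Prime p) : Prime (rename φ p) := by
  have h : rename φ p = rename (Subtype.val : Set.range φ → τ)
      (renameEquiv k (Equiv.ofInjective φ hφ) p) := by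
    rw [renameEquiv_apply, rename_rename]
    rfl
  rw [h, prime_rename_iff]
  exact (MulEquiv.prime_iff (renameEquiv k (Equiv.ofInjective φ hφ))).2 hp

lemma prime_det (k : Type*) [Field k] (n : ℕ) :
    Prime (Matrix.mvPolynomialX (Fin (n + 1)) (Fin (n + 1)) k).det := by
  induction n with
  | zero =>
    rw [Matrix.det_fin_one]
    exact MvPolynomial.X_prime
  | succ n ih =>
    classical
    set M := Matrix.mvPolynomialX (Fin (n + 2)) (Fin (n + 2)) k with hM
    set f : MvPolynomial (Fin (n + 2) × Fin (n + 2)) k := (M.submatrix Fin.succ Fin.succ).det with hf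
    set g : MvPolynomial (Fin (n + 2) × Fin (n + 2)) k :=
      ∑ j : Fin (n + 1), (-1) ^ (j.succ : ℕ) * M 0 j.succ *
        (M.submatrix Fin.succ j.succ.succAbove).det with hg
    have hdet : M.det = f * X (0, 0) + g := by
      rw [Matrix.det_succ_row_zero, Fin.sum_univ_succ]
      simp [f, g, M, mul_comm]
    have hfr : f = rename (Prod.map Fin.succ Fin.succ)
        (Matrix.mvPolynomialX (Fin (n + 1)) (Fin (n + 1)) k).det := by
      rw [AlgHom.map_det]
      rw [hf]
      congr 1
      ext1 i j
      simp [M]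
    have hinj : Function.Injective
        (Prod.map (Fin.succ : Fin (n+1) → Fin (n+2)) (Fin.succ : Fin (n+1) → Fin (n+2))) :=
      (Fin.succ_injective _).prodMap (Fin.succ_injective _)
    have hfp : Prime f := by
      rw [hfr]
      exact prime_rename_of_inj hinj ih
    have hsub : ∀ c : Fin (n + 1) → Fin (n + 2), (M.submatrix Fin.succ c).det ∈
        supported k {p : Fin (n + 2) × Fin (n + 2) | p ≠ (0, 0)} := by
      intro c
      rw [Matrix.det_apply']
      refine Subalgebra.sum_mem _ fun s _ => Subalgebra.mul_mem _ ?_ (Subalgebra.prod_mem _ fun i _ => ?_)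
      · exact intCast_mem _ _
      · simp [M, X_mem_supported, Fin.succ_ne_zero]
    have hnotin : ∀ p ∈ supported k {p : Fin (n + 2) × Fin (n + 2) | p ≠ (0, 0)},
        (0, 0) ∉ p.vars := by
      intro p hp h
      exact (mem_supported.1 hp h) rfl
    refine Irreducible.prime ?_
    rw [hdet]
    refine irreducible_mul_X_add f g (0, 0) hfp.ne_zero (hnotin _ (hsub _)) (hnotin _ ?_) ?_
    · refine Subalgebra.sum_mem _ fun s _ => Subalgebra.mul_mem _ (Subalgebra.mul_mem _ ?_ ?_) (hsub _)
      · exact Subalgebra.pow_mem _ (Subalgebra.neg_mem _ (Subalgebra.one_mem _)) _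
      · simp [M, X_mem_supported, Fin.succ_ne_zero]
    · rw [hfp.irreducible.isRelPrime_iff_not_dvd]
      intro hdvd
      have hd : f ∣ M.det := by rw [hdet]; exact dvd_add (dvd_mul_right _ _) hdvd
      let A : Matrix (Fin (n + 2)) (Fin (n + 2)) k := (Equiv.swap (0 : Fin (n+2)) 1).permMatrix k
      let ev := aeval (R := k) (fun p : Fin (n + 2) × Fin (n + 2) => A p.1 p.2)
      have hMA : ev.mapMatrix M = A := by
        ext i j; simp [M, ev]
      have h1 : ev M.det = A.det := by rw [AlgHom.map_det, hMA]
      have h2 : ev f = 0 := by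
        rw [hf, AlgHom.map_det]
        apply Matrix.det_eq_zero_of_row_eq_zero 0
        intro j
        have : (1 : Fin (n+2)) = Fin.succ 0 := rfl
        simp [M, ev, A, Equiv.Perm.permMatrix, PEquiv.toMatrix_apply, ← this]
        exact (Fin.succ_ne_zero j).symm
      have h3 := map_dvd ev hd
      rw [h1, h2, zero_dvd_iff, Matrix.det_permutation] at h3
      simp at h3

lemma QQ_add {σ k : Type*} [Field k] {N a e : ℕ} {D F G : MvPolynomial σ k}
    (hF : QQ N D a e F) (hG : QQ N D a e G) : QQ N D a e (F + G) := by
  refine ⟨(totalDegree_add F G).trans (max_le hF.1 hG.1), fun j r h => ?_⟩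
  rw [map_add]
  exact dvd_add (hF.2 j r h) (hG.2 j r h)

lemma QQ_smul {σ k : Type*} [Field k] {N a e : ℕ} {D F : MvPolynomial σ k} (c : k)
    (hF : QQ N D a e F) : QQ N D a e (c • F) := by
  refine ⟨(totalDegree_smul_le c F).trans hF.1, fun j r h => ?_⟩
  rw [map_smul, smul_eq_C_mul]
  exact Dvd.dvd.mul_left (hF.2 j r h) _

lemma D_inv (N : ℕ) (k : Type*) [Field k] :
    algebraMap (MvPolynomial (Fin N × Fin N) k) (GLCoord N k) (genericDet N k) *
      Localization.Away.invSelf (genericDet N k) = 1 :=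
  by
  rw [Localization.Away.invSelf, Localization.mk_eq_mk', ← IsLocalization.mk'_one (M := Submonoid.powers (genericDet N k)),
    ← IsLocalization.mk'_mul]
  simp

lemma D_inv_pow (N : ℕ) (k : Type*) [Field k] (i : ℕ) :
    algebraMap (MvPolynomial (Fin N × Fin N) k) (GLCoord N k) (genericDet N k) ^ i *
      Localization.Away.invSelf (genericDet N k) ^ i = 1 := by
  rw [← mul_pow, D_inv, one_pow]

lemma shift (N : ℕ) (k : Type*) [Field k] (F : MvPolynomial (Fin N × Fin N) k) (i b : ℕ) :
    algebraMap (MvPolynomial (Fin N × Fin N) k) (GLCoord N k) (F * genericDet N k ^ b) *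
      Localization.Away.invSelf (genericDet N k) ^ (i + b) =
    algebraMap (MvPolynomial (Fin N × Fin N) k) (GLCoord N k) F *
      Localization.Away.invSelf (genericDet N k) ^ i := by
  have h := D_inv_pow N k b
  rw [map_mul, map_pow, pow_add]
  linear_combination (algebraMap (MvPolynomial (Fin N × Fin N) k) (GLCoord N k) F *
      Localization.Away.invSelf (genericDet N k) ^ i) * h

lemma filt_rep {N : ℕ} {k : Type*} [Field k] (hN : 1 ≤ N) {a e : ℕ} (hae : e ≤ a)
    {f : GLCoord N k} (hf : f ∈ glFilt N k e) :
    ∃ F, f = algebraMap (MvPolynomial (Fin N × Fin N) k) (GLCoord N k) F *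
        Localization.Away.invSelf (genericDet N k) ^ a ∧ QQ N (genericDet N k) a e F := by
  induction hf using Submodule.span_induction with
  | mem y hy =>
    obtain ⟨i, g, hdeg, rfl⟩ := hy
    have hi : i ≤ a := by nlinarith
    obtain ⟨b, rfl⟩ := Nat.exists_eq_add_of_le hi
    have hb : (genericDet N k ^ b).IsHomogeneous (N * b) := (genericDet_hom N k).pow b
    refine ⟨g * genericDet N k ^ b, (shift N k g i b).symm, ?_, ?_⟩
    · refine (totalDegree_mul _ _).trans ?_
      have := hb.totalDegree_le
      nlinarith
    · intro j r hr
      rw [← sum_homogeneousComponent g, Finset.sum_mul, map_sum]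
      refine Finset.dvd_sum fun m hm => ?_
      rw [homogeneousComponent_of_mem (n := m + N * b)
        ((homogeneousComponent_isHomogeneous _ _).mul hb)]
      split_ifs with hj
      · refine Dvd.dvd.mul_left (pow_dvd_pow _ ?_) _
        rw [Finset.mem_range] at hm
        by_contra hlt
        have : 2 * N * (b + 1) ≤ 2 * N * r := by gcongr; omega
        nlinarith
      · simp
  | zero => exact ⟨0, by simp, by simp [QQ]⟩
  | add x y _ _ hx hy =>
    obtain ⟨F, rfl, hF⟩ := hx
    obtain ⟨G, rfl, hG⟩ := hy
    exact ⟨F + G, by rw [map_add, add_mul], QQ_add hF hG⟩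
  | smul c x _ hx =>
    obtain ⟨F, rfl, hF⟩ := hx
    refine ⟨c • F, ?_, QQ_smul c hF⟩
    rw [← smul_mul_assoc]
    congr 1
    rw [Algebra.smul_def, Algebra.smul_def, map_mul, ← IsScalarTower.algebraMap_apply]

lemma filt_of_rep {N : ℕ} {k : Type*} [Field k] (hN : 1 ≤ N) (hD0 : genericDet N k ≠ 0) {a e : ℕ}
    {F : MvPolynomial (Fin N × Fin N) k} (hF : QQ N (genericDet N k) a e F) :
    algebraMap (MvPolynomial (Fin N × Fin N) k) (GLCoord N k) F *
        Localization.Away.invSelf (genericDet N k) ^ a ∈ glFilt N k e := by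
  rw [← sum_homogeneousComponent F, map_sum, Finset.sum_mul]
  refine Submodule.sum_mem _ fun j hj => ?_
  rw [Finset.mem_range] at hj
  by_cases h0 : homogeneousComponent j F = 0
  · simp [h0]
  have hF1 := hF.1
  obtain ⟨r, hr, hr'⟩ : ∃ r, j + a * N ≤ e + 2 * N * r ∧
      genericDet N k ^ r ∣ homogeneousComponent j F := by
    have hex : ∃ r, j + a * N ≤ e + 2 * N * r := ⟨j + a * N, by nlinarith [Nat.zero_le (j + a * N)]⟩
    classical
    refine ⟨Nat.find hex, Nat.find_spec hex, ?_⟩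
    rcases hz : Nat.find hex with _ | r
    · simp
    · apply hF.2
      have := Nat.find_min hex (m := r) (by omega)
      rw [mul_add]
      omega
  obtain ⟨H, hH⟩ := hr'
  have hH0 : H ≠ 0 := by rintro rfl; simp at hH; exact h0 hH
  have hdeg : j = N * r + H.totalDegree := by
    have h1 := (homogeneousComponent_isHomogeneous j F).totalDegree h0
    rw [hH, totalDegree_mul_of_isDomain (pow_ne_zero _ hD0) hH0,
      ((genericDet_hom N k).pow r).totalDegree (pow_ne_zero _ hD0)] at h1
    exact h1.symm
  apply Submodule.subset_span
  rcases le_total a r with har | har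
  · obtain ⟨b, rfl⟩ := Nat.exists_eq_add_of_le har
    refine ⟨0, genericDet N k ^ b * H, ?_, ?_⟩
    · have h1 := totalDegree_mul (genericDet N k ^ b) H
      have h2 := ((genericDet_hom N k).pow b).totalDegree_le
      nlinarith
    · rw [hH, ← shift N k _ 0 a, zero_add]
      congr 2
      ring
  · obtain ⟨b, rfl⟩ := Nat.exists_eq_add_of_le har
    refine ⟨b, H, ?_, ?_⟩
    · nlinarith
    · rw [hH, ← shift N k H b r, add_comm b r, mul_comm H]

/-- The divisibility claim following Proposition 5.2: if `0 ≠ f ∈ O(GL_N)_{≤ e}` and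
`f·g ∈ O(GL_N)_{≤ d}`, then `g ∈ O(GL_N)_{≤ d+e}`. -/
theorem stmt_14 {k : Type*} [Field k] (N : ℕ) (hN : 1 ≤ N) (d e : ℕ)
    (f g : GLCoord N k) (hf0 : f ≠ 0)
    (hf : f ∈ glFilt N k e) (hfg : f * g ∈ glFilt N k d) :
    g ∈ glFilt N k (d + e) := by
  have hp : Prime (genericDet N k) := by
    obtain ⟨n, rfl⟩ := Nat.exists_eq_add_of_le' hN
    rw [genericDet_eq]
    exact prime_det k n
  have hinj : Function.Injective
      (algebraMap (MvPolynomial (Fin N × Fin N) k) (GLCoord N k)) :=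
    IsLocalization.injective _ (powers_le_nonZeroDivisors_of_noZeroDivisors hp.ne_zero)
  obtain ⟨F, rfl, hF⟩ := filt_rep hN le_rfl hf
  obtain ⟨n, G0, hG0⟩ := IsLocalization.Away.surj (genericDet N k) g
  obtain ⟨c, G, hdc, rfl⟩ : ∃ (c : ℕ) (G : MvPolynomial (Fin N × Fin N) k), d ≤ c ∧
      g = algebraMap (MvPolynomial (Fin N × Fin N) k) (GLCoord N k) G *
        Localization.Away.invSelf (genericDet N k) ^ c := by
    refine ⟨n + d, G0 * genericDet N k ^ d, by omega, ?_⟩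
    rw [shift, ← hG0, mul_assoc, D_inv_pow, mul_one]
  obtain ⟨H, hH, hQ⟩ := filt_rep hN (a := e + c) (by omega) hfg
  have hFG : F * G = H := by
    apply hinj
    have h := D_inv_pow N k (e + c)
    rw [map_mul]
    linear_combination (algebraMap (MvPolynomial (Fin N × Fin N) k) (GLCoord N k)
      (genericDet N k) ^ (e + c)) * hH
      - (algebraMap (MvPolynomial (Fin N × Fin N) k) (GLCoord N k) F *
        algebraMap (MvPolynomial (Fin N × Fin N) k) (GLCoord N k) G
        - algebraMap (MvPolynomial (Fin N × Fin N) k) (GLCoord N k) H) * h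
  have hF0 : F ≠ 0 := by
    rintro rfl
    simp at hf0
  subst hFG
  exact filt_of_rep hN hp.ne_zero (core hN hp (genericDet_hom N k) hF0 hF hQ)
end

section
/- Let ρ_M, ρ_E, ρ_Q be coactions on M, E, Q. Let i : M → E be an injective k-linear map and q : E → Q a surjective k-linear map satisfying ρ_E ∘ i = (i ⊗ id_A) ∘ ρ_M, ρ_Q ∘ q = (q ⊗ id_A) ∘ ρ_E, and range i = ker q (so 0 → M → E → Q → 0 is a short exact sequence of comodules). If M and Q are cofinite, then E is cofinite. (Proposition 5.2(2) of the paper.) -/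
open TensorProduct

/-- A coaction `ρ` on `M` is cofinite if `M_X` is finite dimensional for every finite
dimensional subspace `X ⊆ A`. -/
def IsCofinite {k M A : Type*} [Field k] [AddCommGroup M] [Module k M]
    [AddCommGroup A] [Module k A] (ρ : M →ₗ[k] M ⊗[k] A) : Prop :=
  ∀ X : Submodule k A, FiniteDimensional k X → FiniteDimensional k (subMX ρ X)

theorem aux_tmulSub_mono {k M A : Type*} [Field k] [AddCommGroup M] [Module k M]
    [AddCommGroup A] [Module k A] {N N' : Submodule k M} (h : N ≤ N') (X : Submodule k A) :
    tmulSub N X ≤ tmulSub N' X := by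
  rintro _ ⟨w, rfl⟩
  refine ⟨LinearMap.rTensor X (Submodule.inclusion h) w, ?_⟩
  rw [← LinearMap.comp_apply, LinearMap.rTensor, ← TensorProduct.map_comp]
  rfl

theorem aux_subMX {k M A : Type*} [Field k] [AddCommGroup M] [Module k M]
    [AddCommGroup A] [Module k A] (ρ : M →ₗ[k] M ⊗[k] A) (X : Submodule k A) :
    ∀ n ∈ subMX ρ X, ρ n ∈ tmulSub (subMX ρ X) X := by
  have : subMX ρ X ≤ (tmulSub (subMX ρ X) X).comap ρ := by
    refine sSup_le fun N hN n hn => ?_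
    exact aux_tmulSub_mono (le_sSup hN) X (hN n hn)
  exact this

/-- Proposition 5.2(2): if `0 → M → E → Q → 0` is a short exact sequence of comodules
and `M`, `Q` are cofinite, then `E` is cofinite. -/
theorem stmt_17 {k M E Q A : Type*} [Field k] [AddCommGroup M] [Module k M]
    [AddCommGroup E] [Module k E] [AddCommGroup Q] [Module k Q]
    [AddCommGroup A] [Module k A]
    (ρM : M →ₗ[k] M ⊗[k] A) (ρE : E →ₗ[k] E ⊗[k] A) (ρQ : Q →ₗ[k] Q ⊗[k] A)
    (i : M →ₗ[k] E) (q : E →ₗ[k] Q)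
    (hi : Function.Injective i) (hq : Function.Surjective q)
    (hicomm : ρE ∘ₗ i = (LinearMap.rTensor A i) ∘ₗ ρM)
    (hqcomm : ρQ ∘ₗ q = (LinearMap.rTensor A q) ∘ₗ ρE)
    (hexact : LinearMap.range i = LinearMap.ker q)
    (hM : IsCofinite ρM) (hQ : IsCofinite ρQ) :
    IsCofinite ρE := by
  intro X hX
  have hM' := hM X hX
  have hQ' := hQ X hX
  have hN := aux_subMX ρE X
  set N := subMX ρE X with hNdef
  have h1 : N.map q ≤ subMX ρQ X := by
    refine le_sSup ?_
    rintro _ ⟨n, hn, rfl⟩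
    obtain ⟨w, hw⟩ := hN n hn
    have e : ρQ (q n) = LinearMap.rTensor A q (ρE n) := LinearMap.congr_fun hqcomm n
    rw [e, ← hw]
    refine ⟨LinearMap.rTensor X (q.submoduleMap N) w, ?_⟩
    rw [← LinearMap.comp_apply, ← LinearMap.comp_apply, LinearMap.rTensor, LinearMap.rTensor,
      ← TensorProduct.map_comp, ← TensorProduct.map_comp]
    rfl
  have h2 : N.comap i ≤ subMX ρM X := by
    refine le_sSup ?_
    intro m hm
    obtain ⟨w, hw⟩ := hN (i m) hm
    have e : ρE (i m) = LinearMap.rTensor A i (ρM m) := LinearMap.congr_fun hicomm m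
    let j : N.comap i →ₗ[k] N := i.restrict (fun x hx => hx)
    have hex : Function.Exact j (q ∘ₗ N.subtype) := by
      intro y
      constructor
      · intro hy
        have : (y : E) ∈ LinearMap.range i := by rw [hexact]; exact hy
        obtain ⟨x, hx⟩ := this
        exact ⟨⟨x, by rw [Submodule.mem_comap, hx]; exact y.2⟩, Subtype.ext hx⟩
      · rintro ⟨x, rfl⟩
        have : i x ∈ LinearMap.ker q := by rw [← hexact]; exact ⟨_, rfl⟩
        exact this
    have hex2 := Module.Flat.rTensor_exact X hex
    have hqi : q ∘ₗ i = 0 := by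
      ext x
      have : i x ∈ LinearMap.ker q := by rw [← hexact]; exact ⟨_, rfl⟩
      exact this
    have hw0 : LinearMap.rTensor X (q ∘ₗ N.subtype) w = 0 := by
      apply Module.Flat.lTensor_preserves_injective_linearMap (M := Q) X.subtype
        X.injective_subtype
      have h3 : LinearMap.lTensor Q X.subtype (LinearMap.rTensor X (q ∘ₗ N.subtype) w)
          = LinearMap.rTensor A q (TensorProduct.map N.subtype X.subtype w) := by
        rw [← LinearMap.comp_apply, ← LinearMap.comp_apply, LinearMap.rTensor, LinearMap.rTensor,
          LinearMap.lTensor, ← TensorProduct.map_comp, ← TensorProduct.map_comp]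
        rfl
      rw [h3, hw, e, ← LinearMap.comp_apply, ← LinearMap.rTensor_comp, hqi]
      simp
    obtain ⟨v, hv⟩ := (hex2 w).1 hw0
    refine ⟨v, ?_⟩
    apply Module.Flat.rTensor_preserves_injective_linearMap (M := A) i hi
    rw [← e, ← hw, ← hv, ← LinearMap.comp_apply, ← LinearMap.comp_apply, LinearMap.rTensor,
      LinearMap.rTensor, ← TensorProduct.map_comp, ← TensorProduct.map_comp]
    rfl
  have f1 : (N.map q).FG := by
    have := Submodule.finiteDimensional_of_le h1
    exact Module.Finite.iff_fg.1 this
  have f2 : (N.comap i).FG := by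
    have := Submodule.finiteDimensional_of_le h2
    exact Module.Finite.iff_fg.1 this
  refine Module.Finite.iff_fg.2 (Submodule.fg_of_fg_map_of_fg_inf_ker q f1 ?_)
  rw [← hexact, inf_comm, ← Submodule.map_comap_eq]
  exact f2.map i
end

section
/- For every f ∈ k[X], one has f.comp(X + C c) = f for all c ∈ R if and only if f lies in the k-subalgebra Algebra.adjoin k {X^q − X} of k[X]. (This identifies the image of the induced module ind_{G_a(F_q)}^{G_a}(k) inside k[G_a] = k[X] with the polynomials in X^q − X, as asserted in Example 6.8(1) and Proposition 6.9 of the paper.) -/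
open Polynomial

/-- Example 6.8(1) / Proposition 6.9: for `k ⊇ 𝔽_q` (`q = p^r`), a polynomial
`f ∈ k[X]` is invariant under all translations `X ↦ X + c` with `c^q = c` if and only if
`f` is a polynomial in `X^q - X`.  This identifies the image of
`ind_{𝔾_a(𝔽_q)}^{𝔾_a}(k)` inside `k[𝔾_a] = k[X]`. -/
theorem stmt_18 {k : Type*} [Field k] (p r : ℕ) [Fact (Nat.Prime p)] [CharP k p]
    (hr : 1 ≤ r) (q : ℕ) (hq : q = p ^ r)
    (hR : Set.ncard {c : k | c ^ q = c} = q)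
    (f : Polynomial k) :
    (∀ c ∈ {c : k | c ^ q = c}, f.comp (Polynomial.X + Polynomial.C c) = f) ↔
      f ∈ Algebra.adjoin k {Polynomial.X ^ q - Polynomial.X} := by
  have hp := (Fact.out : Nat.Prime p)
  have hq1 : 1 < q := hq ▸ Nat.one_lt_pow (by omega) hp.one_lt
  have hgm : (X ^ q - X : k[X]).Monic := monic_X_pow_sub (by
    rw [degree_X]; exact_mod_cast hq1)
  have hgd : (X ^ q - X : k[X]).natDegree = q := by
    rw [natDegree_sub_eq_left_of_natDegree_lt] <;> simp [hq1]
  have hgc : ∀ c : k, c ^ q = c → (X ^ q - X : k[X]).comp (X + C c) = X ^ q - X := by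
    intro c hc
    haveI : ExpChar k[X] p := ExpChar.prime hp
    have h1 : (X + C c : k[X]) ^ q = X ^ q + C c ^ q := by
      subst hq; exact add_pow_expChar_pow _ _ p r
    simp only [sub_comp, pow_comp, X_comp, h1, ← C_pow, hc]
    ring
  constructor
  · have key : ∀ n : ℕ, ∀ f : k[X], f.natDegree < n →
        (∀ c ∈ {c : k | c ^ q = c}, f.comp (X + C c) = f) →
        f ∈ Algebra.adjoin k {(X ^ q - X : k[X])} := by
      intro n
      induction n with
      | zero => intro f hf; omega
      | succ n ih =>
        intro f hf hinv
        by_cases h0 : f.natDegree = 0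
        · rw [eq_C_of_natDegree_eq_zero h0]
          exact Subalgebra.algebraMap_mem _ (f.coeff 0)
        have hdm := modByMonic_add_div f (X ^ q - X : k[X])
        set g : k[X] := X ^ q - X with hg
        have hml : (f %ₘ g).degree < g.degree := degree_modByMonic_lt _ hgm
        have hu : ∀ c : k, c ^ q = c → f /ₘ g = (f /ₘ g).comp (X + C c) ∧
            f %ₘ g = (f %ₘ g).comp (X + C c) := by
          intro c hc
          apply div_modByMonic_unique _ _ hgm
          constructor
          · conv_rhs => rw [← hinv c hc, ← hdm]
            rw [add_comp, mul_comp, hgc c hc]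
          · refine lt_of_le_of_lt (le_of_eq ?_) hml
            rw [← taylor_apply, degree_taylor]
        have hd : f /ₘ g ∈ Algebra.adjoin k {g} := by
          apply ih
          · rw [natDegree_divByMonic _ hgm, hgd]; omega
          · intro c hc; exact (hu c hc).1.symm
        have hm : f %ₘ g = C ((f %ₘ g).eval 0) := by
          have hfin : {c : k | c ^ q = c}.Finite :=
            Set.finite_of_ncard_ne_zero (by omega)
          rw [← sub_eq_zero]
          apply eq_zero_of_degree_lt_of_eval_finset_eq_zero hfin.toFinset
          · rw [← Set.ncard_eq_toFinset_card _ hfin, hR]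
            rw [degree_eq_natDegree hgm.ne_zero, hgd] at hml
            refine lt_of_le_of_lt (degree_sub_le _ _) (max_lt hml ?_)
            refine lt_of_le_of_lt degree_C_le ?_
            exact_mod_cast (by omega : 0 < q)
          · intro c hc
            have hc' : c ^ q = c := by simpa using hc
            have := congrArg (eval 0) (hu c hc').2
            rw [eval_comp] at this
            simp at this
            simp [this]
        rw [← hdm, hm]
        exact add_mem (Subalgebra.algebraMap_mem _ _)
          (mul_mem (Algebra.subset_adjoin rfl) hd)
    exact key _ f (Nat.lt_succ_self _)
  · intro hf c hc
    rw [Algebra.adjoin_singleton_eq_range_aeval] at hf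
    obtain ⟨h, rfl⟩ := hf
    change (aeval (X ^ q - X : k[X]) h).comp _ = aeval (X ^ q - X : k[X]) h
    have e : (aeval (X ^ q - X : k[X])) h = h.comp (X ^ q - X) := rfl
    rw [e, comp_assoc, hgc c hc]
end
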